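/- arXiv:math/0605745 — 3 statements merged into one kernel-verified Lean document; each statement's English description precedes it below -/
import Mathlib

section
/- Let n ≥ 3 and let v ∈ ℂ^n be null with v₁ + i v₂ ≠ 0. Then there exist φ₁, …, φ_{n−1} ∈ ℂ such that v₁ = φ₁² + … + φ_{n−2}² − φ_{n−1}², v₂ = i(φ₁² + … + φ_{n−2}² + φ_{n−1}²), and v_k = 2 φ_{k−2} φ_{n−1} for k = 3, …, n. -/
open Complex Finset

/-- for `n ≥ 3`, every null vector `v ∈ ℂⁿ` (components indexed `1, …, n`)
with `v₁ + i v₂ ≠ 0` arises from the parametrization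
`v₁ = φ₁² + ⋯ + φ_{n−2}² − φ_{n−1}²`, `v₂ = i(φ₁² + ⋯ + φ_{n−2}² + φ_{n−1}²)`,
`v_k = 2 φ_{k−2} φ_{n−1}` for `k = 3, …, n`. -/
theorem exists_spinor_parametrization_of_null (n : ℕ) (hn : 3 ≤ n) (v : ℕ → ℂ)
    (hnull : ∑ k ∈ Finset.Icc 1 n, v k ^ 2 = 0)
    (hreg : v 1 + Complex.I * v 2 ≠ 0) :
    ∃ φ : ℕ → ℂ,
      v 1 = (∑ a ∈ Finset.Icc 1 (n - 2), φ a ^ 2) - φ (n - 1) ^ 2 ∧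
      v 2 = Complex.I * ((∑ a ∈ Finset.Icc 1 (n - 2), φ a ^ 2) + φ (n - 1) ^ 2) ∧
      ∀ k ∈ Finset.Icc 3 n, v k = 2 * φ (k - 2) * φ (n - 1) := by
  obtain ⟨m, rfl⟩ : ∃ m, n = m + 2 := ⟨n - 2, by omega⟩
  obtain ⟨c, hc⟩ : ∃ c : ℂ, c ^ 2 = -(v 1 + Complex.I * v 2) / 2 :=
    IsAlgClosed.exists_pow_nat_eq _ two_pos
  have hc0 : c ≠ 0 := by
    rintro rfl
    apply hreg
    linear_combination 2 * hc
  have htail : ∑ k ∈ Finset.Icc 1 m, v (k + 2) ^ 2 = -(v 1 ^ 2 + v 2 ^ 2) := by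
    have hshift : ∑ k ∈ Finset.Icc 1 m, v (k + 2) ^ 2 = ∑ k ∈ Finset.Icc 3 (m + 2), v k ^ 2 := by
      rw [← Finset.map_add_right_Icc 1 m 2, Finset.sum_map]
      rfl
    rw [← Finset.add_sum_Ioc_eq_sum_Icc (by omega), ← Finset.Icc_add_one_left_eq_Ioc,
      ← Finset.add_sum_Ioc_eq_sum_Icc (by omega), ← Finset.Icc_add_one_left_eq_Ioc] at hnull
    linear_combination hshift + hnull
  have hsum : ∑ a ∈ Finset.Icc 1 m, (if a = m + 1 then c else v (a + 2) / (2 * c)) ^ 2 =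
      (v 1 - Complex.I * v 2) / 2 := by
    have hterm : ∀ a ∈ Finset.Icc 1 m,
        (if a = m + 1 then c else v (a + 2) / (2 * c)) ^ 2 = v (a + 2) ^ 2 / (4 * c ^ 2) := by
      intro a ha
      rw [if_neg (by have := Finset.mem_Icc.mp ha; omega), div_pow]
      ring
    rw [Finset.sum_congr rfl hterm, ← Finset.sum_div, htail, div_eq_iff (by simpa using hc0)]
    linear_combination
      -2 * (v 1 - Complex.I * v 2) * hc - v 2 ^ 2 * Complex.I_sq
  refine ⟨fun a => if a = m + 1 then c else v (a + 2) / (2 * c), ?_, ?_, ?_⟩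
  · simp only [Nat.add_sub_cancel, show m + 2 - 1 = m + 1 by omega, if_true, hsum]
    linear_combination hc
  · simp only [Nat.add_sub_cancel, show m + 2 - 1 = m + 1 by omega, if_true, hsum]
    linear_combination -Complex.I * hc + v 2 * Complex.I_sq
  · intro k hk
    obtain ⟨hk3, hkn⟩ := Finset.mem_Icc.mp hk
    simp only [show m + 2 - 1 = m + 1 by omega, if_true,
      if_neg (show k - 2 ≠ m + 1 by omega), Nat.sub_add_cancel (show 2 ≤ k by omega)]
    field_simp
end

section
/- Let U ⊆ ℝ³ be open with coordinates (x,y,z) and let φ₁, φ₂ : U → ℂ be twice continuously differentiable. Define the complex 1-form ω = (φ₁² − φ₂²) dx + i(φ₁² + φ₂²) dy + 2φ₁φ₂ dz, and define X₁ = φ₁(x + iy) + φ₂ z, X₂ = −φ₂(x − iy) + φ₁ z and the complex 1-form η = X₁ dφ₁ + X₂ dφ₂ (i.e. η has coefficient η_k = X₁ ∂φ₁/∂x_k + X₂ ∂φ₂/∂x_k in dx_k). Then dω = −2 dη; explicitly, for all indices j, k ∈ {1,2,3} and all points of U, ∂ω_k/∂x_j − ∂ω_j/∂x_k = −2(∂η_k/∂x_j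 − ∂η_j/∂x_k). In particular ω is closed if and only if η is closed. -/
open Complex Finset

/-- Partial derivative of a complex-valued function on `ℝⁿ` in the `k`-th coordinate
direction. -/
noncomputable def pdC {n : ℕ} (f : (Fin n → ℝ) → ℂ) (k : Fin n) (x : Fin n → ℝ) : ℂ :=
  fderiv ℝ f x (Pi.single k 1)

section PartialDerivatives

variable {n : ℕ} {f g : (Fin n → ℝ) → ℂ} {x : Fin n → ℝ}

lemma pdC_add (hf : DifferentiableAt ℝ f x) (hg : DifferentiableAt ℝ g x) (j : Fin n) :
    pdC (fun p => f p + g p) j x = pdC f j x + pdC g j x := by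
  simp [pdC, fderiv_fun_add hf hg]

lemma pdC_sub (hf : DifferentiableAt ℝ f x) (hg : DifferentiableAt ℝ g x) (j : Fin n) :
    pdC (fun p => f p - g p) j x = pdC f j x - pdC g j x := by
  simp [pdC, fderiv_fun_sub hf hg]

lemma pdC_neg (j : Fin n) : pdC (fun p => -f p) j x = -pdC f j x := by
  simp [pdC, fderiv_fun_neg]

lemma pdC_mul (hf : DifferentiableAt ℝ f x) (hg : DifferentiableAt ℝ g x) (j : Fin n) :
    pdC (fun p => f p * g p) j x = f x * pdC g j x + g x * pdC f j x := by
  simp [pdC, fderiv_fun_mul hf hg]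

lemma pdC_const_mul (c : ℂ) (hf : DifferentiableAt ℝ f x) (j : Fin n) :
    pdC (fun p => c * f p) j x = c * pdC f j x := by
  simp [pdC, fderiv_const_mul hf]

lemma pdC_sq (hf : DifferentiableAt ℝ f x) (j : Fin n) :
    pdC (fun p => f p ^ 2) j x = 2 * f x * pdC f j x := by
  simp only [pow_two, pdC_mul hf hf]
  ring

lemma hasFDerivAt_ofReal_coord (i : Fin n) :
    HasFDerivAt (fun p : Fin n → ℝ => (p i : ℂ))
      (Complex.ofRealCLM.comp (ContinuousLinearMap.proj (φ := fun _ : Fin n => ℝ) i)) x :=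
  (Complex.ofRealCLM.comp
    (ContinuousLinearMap.proj (R := ℝ) (φ := fun _ : Fin n => ℝ) i)).hasFDerivAt

lemma pdC_ofReal_coord (i j : Fin n) :
    pdC (fun p : Fin n → ℝ => (p i : ℂ)) j x = if i = j then 1 else 0 := by
  rw [pdC, (hasFDerivAt_ofReal_coord i).fderiv]
  simp [Pi.single_apply, apply_ite Complex.ofReal]

lemma differentiableAt_pdC (hf : ContDiffAt ℝ 2 f x) (k : Fin n) :
    DifferentiableAt ℝ (pdC f k) x := by
  have h : DifferentiableAt ℝ (fderiv ℝ f) x :=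
    (hf.fderiv_right (m := 1) (by norm_num)).differentiableAt (by norm_num)
  exact h.clm_apply (differentiableAt_const _)

lemma pdC_pdC_comm (hf : ContDiffAt ℝ 2 f x) (j k : Fin n) :
    pdC (pdC f k) j x = pdC (pdC f j) k x := by
  have h : DifferentiableAt ℝ (fderiv ℝ f) x :=
    (hf.fderiv_right (m := 1) (by norm_num)).differentiableAt (by norm_num)
  have key (a b : Fin n) : pdC (pdC f a) b x =
      fderiv ℝ (fderiv ℝ f) x (Pi.single b 1) (Pi.single a 1) := by
    change fderiv ℝ (fun y => fderiv ℝ f y (Pi.single a 1)) x (Pi.single b 1) = _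
    rw [fderiv_clm_apply h (differentiableAt_const _)]
    simp
  rw [key, key]
  exact (hf.isSymmSndFDerivAt (by simp)).eq _ _

end PartialDerivatives

/-- on an open `U ⊆ ℝ³` with coordinates `(x, y, z) = (p 0, p 1, p 2)` and
`C²` functions `φ₁, φ₂ : U → ℂ`, for the 1-forms
`ω = (φ₁² − φ₂²) dx + i(φ₁² + φ₂²) dy + 2φ₁φ₂ dz` and `η = X₁ dφ₁ + X₂ dφ₂` with
`X₁ = φ₁(x + iy) + φ₂ z`, `X₂ = −φ₂(x − iy) + φ₁ z`, one has `dω = −2 dη`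
componentwise on `U`; in particular `ω` is closed iff `η` is closed. -/
theorem dOmega_eq_neg_two_dEta_dim3 (U : Set (Fin 3 → ℝ)) (hU : IsOpen U)
    (φ₁ φ₂ : (Fin 3 → ℝ) → ℂ)
    (hφ₁ : ContDiffOn ℝ 2 φ₁ U) (hφ₂ : ContDiffOn ℝ 2 φ₂ U)
    (ω : Fin 3 → (Fin 3 → ℝ) → ℂ)
    (hω : ω = ![fun p => φ₁ p ^ 2 - φ₂ p ^ 2,
                fun p => Complex.I * (φ₁ p ^ 2 + φ₂ p ^ 2),
                fun p => 2 * φ₁ p * φ₂ p])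
    (X₁ X₂ : (Fin 3 → ℝ) → ℂ)
    (hX₁ : X₁ = fun p => φ₁ p * ((p 0 : ℂ) + Complex.I * (p 1 : ℂ)) + φ₂ p * (p 2 : ℂ))
    (hX₂ : X₂ = fun p => -φ₂ p * ((p 0 : ℂ) - Complex.I * (p 1 : ℂ)) + φ₁ p * (p 2 : ℂ))
    (η : Fin 3 → (Fin 3 → ℝ) → ℂ)
    (hη : ∀ k p, η k p = X₁ p * pdC φ₁ k p + X₂ p * pdC φ₂ k p) :
    (∀ x ∈ U, ∀ j k : Fin 3,
        pdC (ω k) j x - pdC (ω j) k x = -2 * (pdC (η k) j x - pdC (η j) k x)) ∧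
    ((∀ x ∈ U, ∀ j k : Fin 3, pdC (ω k) j x - pdC (ω j) k x = 0) ↔
      (∀ x ∈ U, ∀ j k : Fin 3, pdC (η k) j x - pdC (η j) k x = 0)) := by
  have main : ∀ x ∈ U, ∀ j k : Fin 3,
      pdC (ω k) j x - pdC (ω j) k x = -2 * (pdC (η k) j x - pdC (η j) k x) := by
    intro x hx j k
    have c₁ := hφ₁.contDiffAt (hU.mem_nhds hx)
    have c₂ := hφ₂.contDiffAt (hU.mem_nhds hx)
    have d₁ : DifferentiableAt ℝ φ₁ x := c₁.differentiableAt (by norm_num)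
    have d₂ : DifferentiableAt ℝ φ₂ x := c₂.differentiableAt (by norm_num)
    have e (i : Fin 3) : DifferentiableAt ℝ (fun p : Fin 3 → ℝ => (p i : ℂ)) x :=
      (hasFDerivAt_ofReal_coord i).differentiableAt
    have eI := (e 1).const_mul Complex.I
    have ha := (e 0).fun_add eI
    have hb := (e 0).fun_sub eI
    have dX₁ : DifferentiableAt ℝ X₁ x := by
      rw [hX₁]
      exact (d₁.fun_mul ha).fun_add (d₂.fun_mul (e 2))
    have dX₂ : DifferentiableAt ℝ X₂ x := by
      rw [hX₂]
      exact (d₂.fun_neg.fun_mul hb).fun_add (d₁.fun_mul (e 2))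
    have pX₁ (i : Fin 3) : pdC X₁ i x =
        φ₁ x * ((if 0 = i then 1 else 0) + Complex.I * (if 1 = i then 1 else 0))
          + (x 0 + Complex.I * x 1) * pdC φ₁ i x
          + (φ₂ x * (if 2 = i then 1 else 0) + x 2 * pdC φ₂ i x) := by
      rw [hX₁, pdC_add (d₁.fun_mul ha) (d₂.fun_mul (e 2)), pdC_mul d₁ ha, pdC_mul d₂ (e 2),
        pdC_add (e 0) eI, pdC_const_mul _ (e 1)]
      simp only [pdC_ofReal_coord]
    have pX₂ (i : Fin 3) : pdC X₂ i x =
        -φ₂ x * ((if 0 = i then 1 else 0) - Complex.I * (if 1 = i then 1 else 0))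
          + (x 0 - Complex.I * x 1) * -pdC φ₂ i x
          + (φ₁ x * (if 2 = i then 1 else 0) + x 2 * pdC φ₁ i x) := by
      rw [hX₂, pdC_add (d₂.fun_neg.fun_mul hb) (d₁.fun_mul (e 2)), pdC_mul d₂.fun_neg hb,
        pdC_mul d₁ (e 2), pdC_sub (e 0) eI, pdC_const_mul _ (e 1), pdC_neg]
      simp only [pdC_ofReal_coord]
    have pη (i l : Fin 3) : pdC (η l) i x =
        X₁ x * pdC (pdC φ₁ l) i x + pdC φ₁ l x * pdC X₁ i x
          + (X₂ x * pdC (pdC φ₂ l) i x + pdC φ₂ l x * pdC X₂ i x) := by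
      have f₁ := differentiableAt_pdC c₁ l
      have f₂ := differentiableAt_pdC c₂ l
      rw [funext (hη l), pdC_add (dX₁.fun_mul f₁) (dX₂.fun_mul f₂), pdC_mul dX₁ f₁,
        pdC_mul dX₂ f₂]
    have s₁ := d₁.fun_pow 2
    have s₂ := d₂.fun_pow 2
    have pω₀ (i : Fin 3) : pdC (ω 0) i x = 2 * φ₁ x * pdC φ₁ i x - 2 * φ₂ x * pdC φ₂ i x := by
      rw [← pdC_sq d₁, ← pdC_sq d₂, ← pdC_sub s₁ s₂, hω]
      rfl
    have pω₁ (i : Fin 3) : pdC (ω 1) i x =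
        Complex.I * (2 * φ₁ x * pdC φ₁ i x + 2 * φ₂ x * pdC φ₂ i x) := by
      rw [← pdC_sq d₁, ← pdC_sq d₂, ← pdC_add s₁ s₂, ← pdC_const_mul _ (s₁.fun_add s₂), hω]
      rfl
    have pω₂ (i : Fin 3) : pdC (ω 2) i x =
        2 * φ₁ x * pdC φ₂ i x + φ₂ x * (2 * pdC φ₁ i x) := by
      rw [← pdC_const_mul _ d₁, ← pdC_mul (d₁.const_mul 2) d₂, hω]
      rfl
    rw [pη, pη, pdC_pdC_comm c₁ j k, pdC_pdC_comm c₂ j k, pX₁, pX₁, pX₂, pX₂]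
    fin_cases j <;> fin_cases k <;>
      simp [pω₀, pω₁, pω₂] <;> ring
  refine ⟨main, ?_⟩
  refine forall₂_congr fun x hx => forall₂_congr fun j k => ?_
  rw [main x hx j k]
  simp
end

section
/- For all φ₁, φ₂, φ₃, φ₄, φ₅, φ₆ ∈ ℂ, the vector (h_x, h_y, h_z, h_t, h_u) ∈ ℂ⁵ defined by h_x = i(φ₁φ₂ + φ₃φ₄)φ₅ − ½(φ₁² + φ₂² − φ₃² − φ₄²)φ₆, h_y = i(−φ₁φ₃ + φ₂φ₄)φ₅ + (φ₂φ₃ − φ₁φ₄)φ₆, h_z = (−φ₁φ₂ + φ₃φ₄)φ₅ − (i/2)(φ₁² + φ₂² + φ₃² + φ₄²)φ₆, h_t = (φ₁φ₃ + φ₂φ₄)φ₅, h_u = (φ₁φ₃ + φ₂φ₄)φ₆ satisfies the polynomial identity h_x² + h_y² + h_z² + h_t² + h_u² = 0. -/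
open Complex

/-- the trilinear parametrization of null vectors in `ℂ⁵`:
`h_x² + h_y² + h_z² + h_t² + h_u² = 0` for the stated `h_x, …, h_u`. -/
theorem trilinear_parametrization_null (φ₁ φ₂ φ₃ φ₄ φ₅ φ₆ : ℂ) :
    (Complex.I * (φ₁ * φ₂ + φ₃ * φ₄) * φ₅ -
        (1 / 2 : ℂ) * (φ₁ ^ 2 + φ₂ ^ 2 - φ₃ ^ 2 - φ₄ ^ 2) * φ₆) ^ 2 +
      (Complex.I * (-φ₁ * φ₃ + φ₂ * φ₄) * φ₅ + (φ₂ * φ₃ - φ₁ * φ₄) * φ₆) ^ 2 +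
      ((-φ₁ * φ₂ + φ₃ * φ₄) * φ₅ -
        (Complex.I / 2) * (φ₁ ^ 2 + φ₂ ^ 2 + φ₃ ^ 2 + φ₄ ^ 2) * φ₆) ^ 2 +
      ((φ₁ * φ₃ + φ₂ * φ₄) * φ₅) ^ 2 +
      ((φ₁ * φ₃ + φ₂ * φ₄) * φ₆) ^ 2 = 0 := by
  linear_combination
    (((φ₁ * φ₂ + φ₃ * φ₄) ^ 2 + (-φ₁ * φ₃ + φ₂ * φ₄) ^ 2) * φ₅ ^ 2 +
      (1 / 4) * (φ₁ ^ 2 + φ₂ ^ 2 + φ₃ ^ 2 + φ₄ ^ 2) ^ 2 * φ₆ ^ 2) * Complex.I_sq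
end
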